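/- Let n ≥ 1. For all k ≥ 1, p ≥ 1 and all homogeneous matrices in osp(1,2n): str(𝒫_{2k+1}(X₁,…,X_{2k+1})) = 0, str(𝒜_{4p+1}(X₁,…,X_{4p+1})) = 0, and str(𝒜_{4p+2}(X₁,…,X_{4p+2})) = 0; that is, the supertrace invariants P_{2k+1}, Λ_{4p+1} and Λ_{4p+2} vanish identically as multilinear maps on osp(1,2n). -/

import Mathlib

open Matrix

/-- Index type for the ℤ₂-graded space ℂ^p ⊕ ℂ^q. -/
abbrev Idx (p q : ℕ) := Sum (Fin p) (Fin q)

/-- Parity of a basis index. -/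
def ipar {p q : ℕ} : Idx p q → ZMod 2
  | Sum.inl _ => 0
  | Sum.inr _ => 1

/-- `(-1)^a` for `a : ZMod 2`. -/
noncomputable def sgn (a : ZMod 2) : ℂ := if a = 1 then -1 else 1

/-- A matrix is homogeneous of parity `ε` iff it maps the graded piece of
parity `a` into the piece of parity `a + ε`; equivalently, its entry `X i j`
vanishes unless `ipar i = ipar j + ε`. -/
def HasParity {p q : ℕ} (X : Matrix (Idx p q) (Idx p q) ℂ) (ε : ZMod 2) : Prop :=
  ∀ i j, ipar i ≠ ipar j + ε → X i j = 0

/-- A vector is homogeneous of parity `ε`. -/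
def VHasParity {p q : ℕ} (u : Idx p q → ℂ) (ε : ZMod 2) : Prop :=
  ∀ i, ipar i ≠ ε → u i = 0

/-- The super sign `ε(σ, 𝒳) = (-1)^{K(σ,𝒳)}`, where `K(σ,𝒳)` is the number of
pairs `(i,j)` with `i < j`, `σ i > σ j` and both `X (σ i)`, `X (σ j)` odd
(here only the parities `px` of the `X`'s matter). -/
noncomputable def superSign {k : ℕ} (σ : Equiv.Perm (Fin k)) (px : Fin k → ZMod 2) : ℂ :=
  (-1 : ℂ) ^ (Finset.univ.filter (fun ij : Fin k × Fin k =>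
      ij.1 < ij.2 ∧ σ ij.2 < σ ij.1 ∧ px (σ ij.1) = 1 ∧ px (σ ij.2) = 1)).card

/-- The ordered matrix product `X (σ 0) * X (σ 1) * ⋯ * X (σ (k-1))`. -/
noncomputable def permProd {k p q : ℕ} (σ : Equiv.Perm (Fin k))
    (X : Fin k → Matrix (Idx p q) (Idx p q) ℂ) : Matrix (Idx p q) (Idx p q) ℂ :=
  (List.ofFn fun i => X (σ i)).prod

/-- The standard supersymmetric super polynomial `𝒫_k`. -/
noncomputable def symPoly {k p q : ℕ} (X : Fin k → Matrix (Idx p q) (Idx p q) ℂ)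
    (px : Fin k → ZMod 2) : Matrix (Idx p q) (Idx p q) ℂ :=
  ∑ σ : Equiv.Perm (Fin k), superSign σ px • permProd σ X

/-- The standard skew supersymmetric super polynomial `𝒜_k`. -/
noncomputable def skewPoly {k p q : ℕ} (X : Fin k → Matrix (Idx p q) (Idx p q) ℂ)
    (px : Fin k → ZMod 2) : Matrix (Idx p q) (Idx p q) ℂ :=
  ∑ σ : Equiv.Perm (Fin k),
    (((Equiv.Perm.sign σ : ℤ) : ℂ) * superSign σ px) • permProd σ X

/-- The supertrace `str X = tr A - tr D` of a matrix in `gl(p,q)`. -/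
noncomputable def strace {p q : ℕ} (X : Matrix (Idx p q) (Idx p q) ℂ) : ℂ :=
  ∑ i : Fin p, X (Sum.inl i) (Sum.inl i) - ∑ j : Fin q, X (Sum.inr j) (Sum.inr j)

/-- The super bracket `[A,B] = AB - (-1)^{|A||B|} BA` of homogeneous matrices
`A`, `B` of parities `a`, `b`. -/
noncomputable def sbr {p q : ℕ} (A : Matrix (Idx p q) (Idx p q) ℂ) (a : ZMod 2)
    (B : Matrix (Idx p q) (Idx p q) ℂ) (b : ZMod 2) : Matrix (Idx p q) (Idx p q) ℂ :=
  A * B - sgn (a * b) • (B * A)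

/-- The matrix of the even bilinear form `B` on `ℂ ⊕ ℂ^{2n}`: it is `1` on the
even line, `0` between the even and odd parts, and the standard symplectic form
with matrix `[[0, Iₙ],[-Iₙ, 0]]` on `ℂ^{2n}`. -/
noncomputable def Bmat (n : ℕ) : Matrix (Idx 1 (2*n)) (Idx 1 (2*n)) ℂ :=
  fun i j => match i, j with
  | Sum.inl _, Sum.inl _ => 1
  | Sum.inl _, Sum.inr _ => 0
  | Sum.inr _, Sum.inl _ => 0
  | Sum.inr a, Sum.inr b =>
      if a.val + n = b.val then 1 else if b.val + n = a.val then -1 else 0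

/-- The bilinear form `B(u,v)` on `ℂ ⊕ ℂ^{2n}`. -/
noncomputable def Bform (n : ℕ) (u v : Idx 1 (2*n) → ℂ) : ℂ :=
  ∑ i, ∑ j, u i * Bmat n i j * v j

/-- `X` is a homogeneous element of `osp(1,2n)` of parity `ε`:
`B(Xu,v) + (-1)^{|X||u|} B(u,Xv) = 0` for all homogeneous `u`, `v`. -/
def ospMem {n : ℕ} (X : Matrix (Idx 1 (2*n)) (Idx 1 (2*n)) ℂ) (ε : ZMod 2) : Prop :=
  HasParity X ε ∧
  ∀ (u v : Idx 1 (2*n) → ℂ) (εu εv : ZMod 2), VHasParity u εu → VHasParity v εv →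
    Bform n (X.mulVec u) v + sgn (ε * εu) * Bform n u (X.mulVec v) = 0

theorem ZMod.eq_zero_or_eq_one_of_two (a : ZMod 2) : a = 0 ∨ a = 1 := by
  revert a
  decide

theorem sgn_add (a b : ZMod 2) : sgn (a + b) = sgn a * sgn b := by
  rcases a.eq_zero_or_eq_one_of_two with rfl | rfl <;>
    rcases b.eq_zero_or_eq_one_of_two with rfl | rfl <;>
    simp [sgn, CharTwo.add_self_eq_zero]

theorem sgn_sum {ι : Type*} (s : Finset ι) (f : ι → ZMod 2) :
    sgn (∑ i ∈ s, f i) = ∏ i ∈ s, sgn (f i) := by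
  classical
  induction s using Finset.induction_on with
  | empty => simp [sgn]
  | insert a s ha ih => rw [Finset.sum_insert ha, Finset.prod_insert ha, sgn_add, ih]

theorem sgn_mul_eq_ite (a b : ZMod 2) : sgn (a * b) = if a = 1 ∧ b = 1 then -1 else 1 := by
  rcases a.eq_zero_or_eq_one_of_two with rfl | rfl <;>
    rcases b.eq_zero_or_eq_one_of_two with rfl | rfl <;> simp [sgn]

theorem strace_sum {p q : ℕ} {ι : Type*} (s : Finset ι) (f : ι → Matrix (Idx p q) (Idx p q) ℂ) :
    strace (∑ i ∈ s, f i) = ∑ i ∈ s, strace (f i) := by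
  simp only [strace, Matrix.sum_apply, Finset.sum_sub_distrib]
  rw [Finset.sum_comm, Finset.sum_comm (s := Finset.univ) (t := s)]

theorem strace_smul {p q : ℕ} (c : ℂ) (A : Matrix (Idx p q) (Idx p q) ℂ) :
    strace (c • A) = c * strace A := by
  simp [strace, mul_sub, Finset.mul_sum]

/-- The diagonal matrix acting on the piece of parity `a` by `(-1)^(ε * a)`. -/
noncomputable def parityMatrix (p q : ℕ) (ε : ZMod 2) : Matrix (Idx p q) (Idx p q) ℂ :=
  Matrix.diagonal fun i => sgn (ε * ipar i)

theorem parityMatrix_zero (p q : ℕ) : parityMatrix p q 0 = 1 := by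
  simp [parityMatrix, sgn]

theorem parityMatrix_add (p q : ℕ) (a b : ZMod 2) :
    parityMatrix p q (a + b) = parityMatrix p q a * parityMatrix p q b := by
  simp [parityMatrix, add_mul, sgn_add]

theorem strace_eq_trace {p q : ℕ} (A : Matrix (Idx p q) (Idx p q) ℂ) :
    strace A = (parityMatrix p q 1 * A).trace := by
  simp [strace, parityMatrix, Matrix.trace, ipar, sgn, sub_eq_add_neg]

theorem HasParity.mul {p q : ℕ} {A B : Matrix (Idx p q) (Idx p q) ℂ} {a b : ZMod 2}
    (hA : HasParity A a) (hB : HasParity B b) : HasParity (A * B) (a + b) := by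
  intro i j hij
  rw [Matrix.mul_apply]
  refine Finset.sum_eq_zero fun k _ => ?_
  by_cases h : ipar i = ipar k + a
  · rw [hB k j fun h' => hij (by rw [h, h', add_assoc, add_comm b a]), mul_zero]
  · rw [hA i k h, zero_mul]

theorem HasParity.one {p q : ℕ} : HasParity (1 : Matrix (Idx p q) (Idx p q) ℂ) 0 := by
  intro i j hij
  exact Matrix.one_apply_ne fun h => hij (by simp [h])

theorem HasParity.strace_eq_zero {p q : ℕ} {A : Matrix (Idx p q) (Idx p q) ℂ}
    (hA : HasParity A 1) : strace A = 0 := by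
  have h (i : Idx p q) : A i i = 0 := hA i i (by simp)
  simp [strace, h]

theorem HasParity.transpose_mul_parityMatrix {p q : ℕ} {A : Matrix (Idx p q) (Idx p q) ℂ}
    {a : ZMod 2} (hA : HasParity A a) (ε : ZMod 2) :
    Aᵀ * parityMatrix p q ε = sgn (ε * a) • (parityMatrix p q ε * Aᵀ) := by
  ext i j
  simp only [parityMatrix, Matrix.mul_diagonal, Matrix.smul_apply, Matrix.diagonal_mul,
    Matrix.transpose_apply, smul_eq_mul]
  by_cases h : ipar j = ipar i + a
  · rw [h, mul_add, sgn_add]; ring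
  · rw [hA j i h]; ring

theorem HasParity.commute_parityMatrix {p q : ℕ} {A : Matrix (Idx p q) (Idx p q) ℂ}
    (hA : HasParity A 0) (ε : ZMod 2) : Commute A (parityMatrix p q ε) := by
  have h := congrArg Matrix.transpose (hA.transpose_mul_parityMatrix ε)
  simpa [Commute, SemiconjBy, sgn, parityMatrix] using h.symm

/-- `∏_{i < j} (-1)^(px i * px j)`. -/
noncomputable def pairSign {k : ℕ} (px : Fin k → ZMod 2) : ℂ :=
  ∏ i, ∏ j ∈ Finset.Ioi i, sgn (px i * px j)

theorem pairSign_succ {k : ℕ} (px : Fin (k + 1) → ZMod 2) :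
    pairSign px = sgn (px 0 * ∑ i : Fin k, px i.succ) * pairSign fun i => px i.succ := by
  simp only [pairSign, Fin.prod_univ_succ, Fin.prod_Ioi_zero, Fin.prod_Ioi_succ, Finset.mul_sum,
    sgn_sum]

theorem pairSign_eq_pow {k : ℕ} (px : Fin k → ZMod 2) :
    pairSign px = (-1 : ℂ) ^ (Finset.univ.filter (fun ij : Fin k × Fin k =>
      ij.1 < ij.2 ∧ px ij.1 = 1 ∧ px ij.2 = 1)).card := by
  rw [← Finset.prod_const, Finset.prod_filter, Fintype.prod_prod_type]
  refine Finset.prod_congr rfl fun i _ => ?_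
  rw [← Finset.filter_lt_eq_Ioi, Finset.prod_filter]
  exact Finset.prod_congr rfl fun j _ => by rw [sgn_mul_eq_ite, ← ite_and]

/-- If each `X i` is skew for the super bilinear form with matrix `B`, the super adjoint of an
ordered product is, up to sign, the product in the opposite order. -/
theorem superadjoint_prod {p q : ℕ} {B : Matrix (Idx p q) (Idx p q) ℂ} {k : ℕ}
    (X : Fin k → Matrix (Idx p q) (Idx p q) ℂ) (px : Fin k → ZMod 2)
    (hX : ∀ i, HasParity (X i) (px i))
    (hB : ∀ i, (X i)ᵀ * B = -(parityMatrix p q (px i) * (B * X i))) :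
    HasParity (List.ofFn X).prod (∑ i, px i) ∧
    (List.ofFn X).prodᵀ * B = ((-1) ^ k * pairSign px) •
      (parityMatrix p q (∑ i, px i) * (B * (List.ofFn X).reverse.prod)) := by
  induction k with
  | zero => simpa [pairSign, parityMatrix_zero] using HasParity.one
  | succ k ih =>
    obtain ⟨ihp, ihB⟩ := ih (fun i => X i.succ) (fun i => px i.succ) (fun i => hX _)
      (fun i => hB _)
    rw [List.ofFn_succ, List.prod_cons, Fin.sum_univ_succ, List.reverse_cons, List.prod_append,
      List.prod_singleton]
    refine ⟨(hX 0).mul ihp, ?_⟩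
    set P := (List.ofFn fun i => X i.succ).prod
    set Q := (List.ofFn fun i => X i.succ).reverse.prod
    rw [Matrix.transpose_mul, Matrix.mul_assoc, hB 0, Matrix.mul_neg, ← Matrix.mul_assoc,
      ihp.transpose_mul_parityMatrix, Matrix.smul_mul, Matrix.mul_assoc, ← Matrix.mul_assoc Pᵀ,
      ihB, pairSign_succ, parityMatrix_add]
    simp only [Matrix.smul_mul, Matrix.mul_smul, smul_smul, Matrix.mul_assoc, ← neg_smul]
    congr 1
    ring

theorem List.reverse_ofFn_eq {α : Type*} {k : ℕ} (f : Fin k → α) :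
    (List.ofFn f).reverse = List.ofFn fun i => f i.rev := by
  refine List.ext_getElem (by simp) fun i h₁ h₂ => ?_
  simp only [List.getElem_reverse, List.getElem_ofFn, List.length_ofFn]
  congr 1
  ext
  simp only [Fin.val_rev]
  omega

theorem strace_prod_reverse {p q : ℕ} {B C : Matrix (Idx p q) (Idx p q) ℂ} (hBC : B * C = 1)
    (hB₀ : HasParity B 0) {k : ℕ}
    (X : Fin k → Matrix (Idx p q) (Idx p q) ℂ) (px : Fin k → ZMod 2)
    (hX : ∀ i, HasParity (X i) (px i))
    (hB : ∀ i, (X i)ᵀ * B = -(parityMatrix p q (px i) * (B * X i))) :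
    strace (List.ofFn X).prod = (-1) ^ k * pairSign px * strace (List.ofFn X).reverse.prod := by
  obtain ⟨hp, h⟩ := superadjoint_prod X px hX hB
  have hrev : HasParity (List.ofFn X).reverse.prod (∑ i, px i) := by
    have := (superadjoint_prod (B := 0) (fun i => X i.rev) (fun i => px i.rev)
      (fun i => hX _) (by simp)).1
    rw [← List.reverse_ofFn_eq] at this
    rwa [← Equiv.sum_comp Fin.revPerm px]
  set P := (List.ofFn X).prod
  set Q := (List.ofFn X).reverse.prod
  obtain h0 | h1 := (∑ i, px i).eq_zero_or_eq_one_of_two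
  · rw [h0, parityMatrix_zero, Matrix.one_mul] at h
    have hPt : Pᵀ = ((-1) ^ k * pairSign px) • (B * Q * C) := by
      rw [← Matrix.smul_mul, ← h, Matrix.mul_assoc, hBC, Matrix.mul_one]
    have hCB : C * B = 1 := mul_eq_one_comm.mp hBC
    rw [strace_eq_trace, strace_eq_trace, ← Matrix.trace_transpose, Matrix.transpose_mul, hPt,
      Matrix.smul_mul, Matrix.trace_smul, smul_eq_mul]
    congr 1
    have hG : (parityMatrix p q 1)ᵀ = parityMatrix p q 1 := by simp [parityMatrix]
    rw [hG, Matrix.mul_assoc, Matrix.mul_assoc, Matrix.trace_mul_comm, Matrix.mul_assoc,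
      Matrix.mul_assoc, ← (hB₀.commute_parityMatrix 1).eq, ← Matrix.mul_assoc C, hCB,
      Matrix.one_mul, Matrix.trace_mul_comm]
  · rw [h1] at hp hrev
    rw [hp.strace_eq_zero, hrev.strace_eq_zero, mul_zero]

theorem superSign_mul_revPerm {k : ℕ} (σ : Equiv.Perm (Fin k)) (px : Fin k → ZMod 2) :
    superSign σ px * superSign (σ * Fin.revPerm) px = pairSign fun i => px (σ i) := by
  rw [pairSign_eq_pow, superSign, superSign, ← pow_add]
  congr 1
  have hrev : (Finset.univ.filter (fun ij : Fin k × Fin k =>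
        ij.1 < ij.2 ∧
        (σ * Fin.revPerm : Equiv.Perm (Fin k)) ij.2 < (σ * Fin.revPerm : Equiv.Perm (Fin k)) ij.1 ∧
        px ((σ * Fin.revPerm : Equiv.Perm (Fin k)) ij.1) = 1 ∧
        px ((σ * Fin.revPerm : Equiv.Perm (Fin k)) ij.2) = 1)).card =
      (Finset.univ.filter (fun ij : Fin k × Fin k =>
        ij.1 < ij.2 ∧ ¬ σ ij.2 < σ ij.1 ∧ px (σ ij.1) = 1 ∧ px (σ ij.2) = 1)).card := by
    refine Finset.card_nbij' (fun ij => (ij.2.rev, ij.1.rev)) (fun ij => (ij.2.rev, ij.1.rev))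
      ?_ ?_ (fun _ _ => by simp) (fun _ _ => by simp)
    · rintro ⟨i, j⟩ h
      simp only [Finset.coe_filter, Finset.mem_univ, true_and, Set.mem_ofPred_eq,
        Equiv.Perm.mul_apply, Fin.revPerm_apply, Fin.rev_lt_rev] at h ⊢
      exact ⟨h.1, h.2.1.not_gt, h.2.2.2, h.2.2.1⟩
    · rintro ⟨i, j⟩ h
      simp only [Finset.coe_filter, Finset.mem_univ, true_and, Set.mem_ofPred_eq,
        Equiv.Perm.mul_apply, Fin.revPerm_apply, Fin.rev_lt_rev, Fin.rev_rev] at h ⊢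
      exact ⟨h.1, lt_of_le_of_ne (not_lt.mp h.2.1) fun e => h.1.ne (σ.injective e),
        h.2.2.2, h.2.2.1⟩
  rw [hrev, ← Finset.card_filter_add_card_filter_not (s := Finset.univ.filter
    (fun ij : Fin k × Fin k => ij.1 < ij.2 ∧ px (σ ij.1) = 1 ∧ px (σ ij.2) = 1))
    (fun ij => σ ij.2 < σ ij.1), Finset.filter_filter, Finset.filter_filter]
  congr 3 <;> ext <;> tauto

theorem superSign_revPerm {k : ℕ} (σ : Equiv.Perm (Fin k)) (px : Fin k → ZMod 2) :
    superSign σ px * (pairSign fun i => px (σ i)) = superSign (σ * Fin.revPerm) px := by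
  rw [← superSign_mul_revPerm, ← mul_assoc, superSign, ← pow_add, ← two_mul, pow_mul]
  simp

theorem sign_revPerm (k : ℕ) :
    Equiv.Perm.sign (Fin.revPerm : Equiv.Perm (Fin k)) = (-1) ^ (k * (k - 1) / 2) := by
  have h (i : Fin k) : (∏ j ∈ Finset.Ioi i,
      (if Fin.revPerm i < Fin.revPerm j then 1 else -1 : ℤˣ)) = (-1) ^ (k - 1 - (i : ℕ)) := by
    rw [Finset.prod_congr rfl fun j hj => if_neg ?_, Finset.prod_const, Fin.card_Ioi]
    simpa using (Finset.mem_Ioi.mp hj).le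
  rw [Equiv.Perm.sign_eq_prod_prod_Ioi, Finset.prod_congr rfl fun i _ => h i,
    Finset.prod_pow_eq_pow_sum, Fin.sum_univ_eq_sum_range (fun i => k - 1 - i) k,
    Finset.sum_range_reflect (fun i => i) k, Finset.sum_range_id]

theorem Bmat_hasParity (n : ℕ) : HasParity (Bmat n) 0 := by
  rintro (i | i) (j | j) h <;> simp_all [ipar, Bmat]

theorem Bmat_mul_transpose (n : ℕ) : Bmat n * (Bmat n)ᵀ = 1 := by
  ext (i | a) (j | b)
  · simp [Matrix.mul_apply, Bmat, Matrix.one_apply, Subsingleton.elim i j]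
  · simp [Matrix.mul_apply, Bmat]
  · simp [Matrix.mul_apply, Bmat]
  · have ha := a.isLt
    obtain ⟨c, hc⟩ : ∃ c : Fin (2 * n), a.val + n = c.val ∨ c.val + n = a.val := by
      rcases lt_or_ge a.val n with h | h
      · exact ⟨⟨a.val + n, by omega⟩, Or.inl rfl⟩
      · exact ⟨⟨a.val - n, by omega⟩, Or.inr (by simp only; omega)⟩
    have hz (d : Fin (2 * n)) (hd : d ≠ c) : Bmat n (Sum.inr a) (Sum.inr d) = 0 := by
      have hd' : d.val ≠ c.val := fun h => hd (Fin.ext h)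
      simp only [Bmat]
      rw [if_neg (by omega), if_neg (by omega)]
    simp only [Matrix.mul_apply, Fintype.sum_sum_type, Matrix.transpose_apply]
    rw [Finset.sum_eq_single c (fun d _ hd => by rw [hz d hd, zero_mul]) (by simp)]
    simp only [Bmat, Matrix.one_apply, Sum.inr.injEq, Fin.ext_iff]
    split_ifs <;> first | omega | simp

theorem ospMem.transpose_mul {n : ℕ} {X : Matrix (Idx 1 (2 * n)) (Idx 1 (2 * n)) ℂ} {ε : ZMod 2}
    (hX : ospMem X ε) :
    Xᵀ * Bmat n = -(parityMatrix 1 (2 * n) ε * (Bmat n * X)) := by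
  ext i j
  have hs (i : Idx 1 (2 * n)) : VHasParity (Pi.single i 1) (ipar i) := by
    intro k hk
    exact Pi.single_eq_of_ne (fun h => hk (by rw [h])) 1
  have h := hX.2 _ _ _ _ (hs i) (hs j)
  have hform (u v : Idx 1 (2 * n) → ℂ) : Bform n u v = u ⬝ᵥ Bmat n *ᵥ v := by
    simp only [Bform, dotProduct, Matrix.mulVec, Finset.mul_sum, mul_assoc]
  rw [hform, hform, Matrix.mulVec_mulVec, Matrix.mulVec_single_one, Matrix.mulVec_single_one,
    Matrix.mulVec_single_one, single_one_dotProduct] at h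
  rw [Matrix.neg_apply, parityMatrix, Matrix.diagonal_mul]
  exact eq_neg_of_add_eq_zero_left h

/-- A weighted sum of super-signed products over the symmetric group has zero supertrace on
`osp(1,2n)` when reversal of the order changes the weight by `-(-1)^k`. -/
theorem strace_sum_permProd_eq_zero {n k : ℕ}
    (X : Fin k → Matrix (Idx 1 (2 * n)) (Idx 1 (2 * n)) ℂ) (px : Fin k → ZMod 2)
    (hX : ∀ i, ospMem (X i) (px i)) (w : Equiv.Perm (Fin k) → ℂ)
    (hw : ∀ σ, w (σ * Fin.revPerm) = -(-1) ^ k * w σ) :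
    strace (∑ σ : Equiv.Perm (Fin k), (w σ * superSign σ px) • permProd σ X) = 0 := by
  rw [strace_sum, ← self_eq_neg, ← Finset.sum_neg_distrib]
  conv_rhs => rw [← Equiv.sum_comp (Equiv.mulRight Fin.revPerm)]
  refine Finset.sum_congr rfl fun σ _ => ?_
  have h := strace_prod_reverse (Bmat_mul_transpose n) (Bmat_hasParity n) (fun i => X (σ i))
    (fun i => px (σ i)) (fun i => (hX _).1) (fun i => (hX _).transpose_mul)
  rw [List.reverse_ofFn_eq] at h
  rw [strace_smul, strace_smul, permProd, h, Equiv.coe_mulRight, hw, ← superSign_revPerm]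
  simp only [permProd, Equiv.Perm.mul_apply, Fin.revPerm_apply]
  ring

theorem strace_skewPoly_eq_zero {n k : ℕ} (hk : Odd (k + k * (k - 1) / 2))
    (X : Fin k → Matrix (Idx 1 (2 * n)) (Idx 1 (2 * n)) ℂ) (px : Fin k → ZMod 2)
    (hX : ∀ i, ospMem (X i) (px i)) : strace (skewPoly X px) = 0 := by
  refine strace_sum_permProd_eq_zero X px hX (fun σ => ((Equiv.Perm.sign σ : ℤ) : ℂ)) fun σ => ?_
  have h : (-1 : ℂ) ^ (k * (k - 1) / 2) = -(-1) ^ k := by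
    have h1 := hk.neg_one_pow (α := ℂ)
    rw [pow_add] at h1
    have h2 : (-1 : ℂ) ^ k * (-1) ^ k = 1 := by rw [← pow_add, ← two_mul, pow_mul]; simp
    linear_combination (-1) ^ k * h1 - (-1) ^ (k * (k - 1) / 2) * h2
  rw [Equiv.Perm.sign_mul, sign_revPerm, ← h]
  push_cast
  ring

/-- The supertrace invariants `P_{2k+1}`, `Λ_{4p+1}` and `Λ_{4p+2}` vanish
identically as multilinear maps on `osp(1,2n)`. -/
theorem strace_invariants_vanish_on_osp (n : ℕ) (hn : 1 ≤ n) :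
    (∀ (k : ℕ), 1 ≤ k →
      ∀ (X : Fin (2*k+1) → Matrix (Idx 1 (2*n)) (Idx 1 (2*n)) ℂ)
        (px : Fin (2*k+1) → ZMod 2), (∀ i, ospMem (X i) (px i)) →
        strace (symPoly X px) = 0) ∧
    (∀ (p : ℕ), 1 ≤ p →
      ∀ (X : Fin (4*p+1) → Matrix (Idx 1 (2*n)) (Idx 1 (2*n)) ℂ)
        (px : Fin (4*p+1) → ZMod 2), (∀ i, ospMem (X i) (px i)) →
        strace (skewPoly X px) = 0) ∧
    (∀ (p : ℕ), 1 ≤ p →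
      ∀ (X : Fin (4*p+2) → Matrix (Idx 1 (2*n)) (Idx 1 (2*n)) ℂ)
        (px : Fin (4*p+2) → ZMod 2), (∀ i, ospMem (X i) (px i)) →
        strace (skewPoly X px) = 0) := by
  refine ⟨fun k _ X px hX => ?_, fun p _ X px hX => ?_, fun p _ X px hX => ?_⟩
  · have h := strace_sum_permProd_eq_zero X px hX (fun _ => 1)
      fun σ => by simp [(odd_two_mul_add_one k).neg_one_pow]
    simpa only [one_mul, symPoly] using h
  · refine strace_skewPoly_eq_zero ?_ X px hX
    rw [show (4 * p + 1) * (4 * p + 1 - 1) = 2 * ((4 * p + 1) * (2 * p)) by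
      rw [Nat.add_sub_cancel]; ring, Nat.mul_div_cancel_left _ two_pos]
    exact ⟨2 * p + (4 * p + 1) * p, by ring⟩
  · refine strace_skewPoly_eq_zero ?_ X px hX
    rw [show (4 * p + 2) * (4 * p + 2 - 1) = 2 * ((2 * p + 1) * (4 * p + 1)) by
      rw [show 4 * p + 2 - 1 = 4 * p + 1 from rfl]; ring, Nat.mul_div_cancel_left _ two_pos]
    exact ⟨4 * p ^ 2 + 5 * p + 1, by ring⟩
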